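/- For every decorated tree τ with w(τ) > 1 and every seed tree S, the second moments satisfy E[D_τ(T_n^{(S)})²] ≪ n^{w(τ)}. -/

import Mathlib

open Finset

noncomputable section

namespace LPAM

attribute [local instance] Classical.propDecidable

/-- The tree obtained from `G` by attaching a new vertex (the last element of `Fin (n+1)`)
to the vertex `v` of `G`. -/
def attach {n : ℕ} (G : SimpleGraph (Fin n)) (v : Fin n) : SimpleGraph (Fin (n + 1)) :=
  SimpleGraph.fromRel fun a b =>
    (∃ a' b' : Fin n, a = a'.castSucc ∧ b = b'.castSucc ∧ G.Adj a' b') ∨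
    (a = Fin.last n ∧ b = v.castSucc)

/-- The degree of a vertex. -/
def deg {n : ℕ} (G : SimpleGraph (Fin n)) (v : Fin n) : ℕ := (G.neighborSet v).ncard

/-- The law of the linear preferential attachment tree after `k` steps started from the
seed `S`: at each step, a new vertex is joined by an edge to a random vertex of the current
tree chosen with probability proportional to its degree. -/
def law {n₀ : ℕ} (S : SimpleGraph (Fin n₀)) : (k : ℕ) → SimpleGraph (Fin (n₀ + k)) → ℝ
  | 0, G => if G = S then 1 else 0
  | (k + 1), G =>
      ∑ H : SimpleGraph (Fin (n₀ + k)), ∑ v : Fin (n₀ + k),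
        law S k H * ((deg H v : ℝ) / (2 * (n₀ + k : ℕ) - 2)) *
          (if attach H v = G then 1 else 0)

/-- The law of the preferential attachment tree `T_n^{(S)}` with seed `S`, as a function on
graphs on `Fin n` (zero if `n < |S|`). -/
def lawAt {n₀ : ℕ} (S : SimpleGraph (Fin n₀)) (n : ℕ) (G : SimpleGraph (Fin n)) : ℝ :=
  if h : n₀ ≤ n then
    law S (n - n₀) (cast (congrArg (fun m => SimpleGraph (Fin m)) (Nat.add_sub_cancel' h).symm) G)
  else 0

/-- A decorated tree: a finite tree together with a positive integer label on each vertex. -/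
structure DecTree where
  n : ℕ
  graph : SimpleGraph (Fin n)
  isTree : graph.IsTree
  label : Fin n → ℕ
  label_pos : ∀ u, 0 < label u

/-- The weight of a decorated tree: the sum of its labels. -/
def DecTree.weight (τ : DecTree) : ℕ := ∑ u, τ.label u

/-- The strict partial order `≺` on decorated trees. -/
def DecTree.lt (τ' τ : DecTree) : Prop :=
  (τ'.weight < τ.weight ∧ τ'.n ≤ τ.n) ∨ (τ'.weight = τ.weight ∧ τ'.n < τ.n)

/-- The partial order `⪯` associated with `≺`. -/
def DecTree.le (τ' τ : DecTree) : Prop := DecTree.lt τ' τ ∨ τ' = τ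

/-- The observable `D_τ(T) = ∑_φ ∏_{u ∈ τ} [deg_T φ(u)]_{ℓ(u)}`, the sum running over all
embeddings (injective graph homomorphisms) `φ : τ → T`. -/
def Dval (τ : DecTree) {m : ℕ} (T : SimpleGraph (Fin m)) : ℝ :=
  ∑ φ : Fin τ.n → Fin m,
    if Function.Injective φ ∧ ∀ a b, τ.graph.Adj a b → T.Adj (φ a) (φ b) then
      ∏ u, ((deg T (φ u)).descFactorial (τ.label u) : ℝ)
    else 0

/-- The expectation `E[D_τ(T_n^{(S)})]`. -/
def expD {n₀ : ℕ} (S : SimpleGraph (Fin n₀)) (τ : DecTree) (n : ℕ) : ℝ :=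
  ∑ G : SimpleGraph (Fin n), lawAt S n G * Dval τ G

/-- `a ≪ b` : there are `c > 0` and `γ ∈ ℝ` with `|a_n| ≤ c (log n)^γ |b_n|` for `n` large. -/
def Lsim (a b : ℕ → ℝ) : Prop :=
  ∃ c γ : ℝ, 0 < c ∧ ∀ᶠ n : ℕ in Filter.atTop, |a n| ≤ c * Real.log n ^ γ * |b n|

end LPAM

namespace LPAM

section

attribute [local instance] Classical.propDecidable

lemma attach_adj_castSucc {n : ℕ} (G : SimpleGraph (Fin n)) (v a b : Fin n) :
    (attach G v).Adj a.castSucc b.castSucc ↔ G.Adj a b := by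
  simp only [attach, SimpleGraph.fromRel_adj]
  constructor
  · rintro ⟨-, (⟨a', b', ha, hb, h⟩ | ⟨ha, -⟩) | (⟨a', b', ha, hb, h⟩ | ⟨hb, -⟩)⟩
    · rw [Fin.castSucc_inj] at ha hb; subst ha hb; exact h
    · exact absurd ha (Fin.castSucc_ne_last a)
    · rw [Fin.castSucc_inj] at ha hb; subst ha hb; exact h.symm
    · exact absurd hb (Fin.castSucc_ne_last b)
  · intro h
    exact ⟨fun e => h.ne (Fin.castSucc_injective _ e), Or.inl (Or.inl ⟨a, b, rfl, rfl, h⟩)⟩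

lemma attach_adj_last {n : ℕ} (G : SimpleGraph (Fin n)) (v b : Fin n) :
    (attach G v).Adj (Fin.last n) b.castSucc ↔ b = v := by
  simp only [attach, SimpleGraph.fromRel_adj]
  constructor
  · rintro ⟨-, (⟨a', b', ha, hb, h⟩ | ⟨-, hb⟩) | (⟨a', b', ha, hb, h⟩ | ⟨hb, -⟩)⟩
    · exact absurd ha.symm (Fin.castSucc_ne_last _)
    · exact Fin.castSucc_injective _ hb
    · exact absurd hb.symm (Fin.castSucc_ne_last _)
    · exact absurd hb (Fin.castSucc_ne_last b)
  · rintro rfl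
    exact ⟨(Fin.castSucc_ne_last _).symm, Or.inl (Or.inr (by simp))⟩

lemma deg_attach_castSucc {n : ℕ} (G : SimpleGraph (Fin n)) (v a : Fin n) :
    deg (attach G v) a.castSucc = deg G a + if a = v then 1 else 0 := by
  have hdisj : Fin.last n ∉ Fin.castSucc '' G.neighborSet a := by
    rintro ⟨b, -, hb⟩
    exact Fin.castSucc_ne_last b hb
  have himg : (Fin.castSucc '' G.neighborSet a).ncard = deg G a :=
    Set.ncard_image_of_injective _ (Fin.castSucc_injective n)
  unfold deg
  split_ifs with h
  · have : (attach G v).neighborSet a.castSucc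
        = insert (Fin.last n) (Fin.castSucc '' G.neighborSet a) := by
      ext x
      induction x using Fin.lastCases with
      | last =>
        rw [SimpleGraph.mem_neighborSet, (attach G v).adj_comm, attach_adj_last]
        simp [h]
      | cast b => simp [attach_adj_castSucc, Fin.castSucc_ne_last]
    rw [this, Set.ncard_insert_of_notMem hdisj, himg, deg]
  · have : (attach G v).neighborSet a.castSucc = Fin.castSucc '' G.neighborSet a := by
      ext x
      induction x using Fin.lastCases with
      | last =>
        rw [SimpleGraph.mem_neighborSet, (attach G v).adj_comm, attach_adj_last]
        exact iff_of_false h hdisj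
      | cast b => simp [attach_adj_castSucc]
    rw [this, himg, deg, add_zero]

lemma deg_attach_last {n : ℕ} (G : SimpleGraph (Fin n)) (v : Fin n) :
    deg (attach G v) (Fin.last n) = 1 := by
  have : (attach G v).neighborSet (Fin.last n) = {v.castSucc} := by
    ext x
    induction x using Fin.lastCases with
    | last => simp [(Fin.castSucc_ne_last _).symm]
    | cast b => simp [attach_adj_last]
  rw [deg, this, Set.ncard_singleton]

lemma sum_deg_attach {n : ℕ} (G : SimpleGraph (Fin n)) (v : Fin n) :
    ∑ a, deg (attach G v) a = ∑ a, deg G a + 2 := by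
  simp [Fin.sum_univ_castSucc, deg_attach_castSucc, deg_attach_last, sum_add_distrib]

lemma sum_deg_of_isTree {n : ℕ} {S : SimpleGraph (Fin n)} (hS : S.IsTree) :
    ∑ a, deg S a + 2 = 2 * n := by
  have h1 : ∑ a, deg S a = ∑ a, S.degree a := by
    refine sum_congr rfl fun a _ => ?_
    rw [deg, Set.ncard_eq_toFinset_card', ← SimpleGraph.neighborFinset_def,
      SimpleGraph.card_neighborFinset_eq_degree]
  have h2 := S.sum_degrees_eq_twice_card_edges
  have h3 := hS.card_edgeFinset
  rw [Fintype.card_fin] at h3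
  omega

lemma sum_deg_of_law_ne_zero {n₀ : ℕ} {S : SimpleGraph (Fin n₀)} (hS : S.IsTree) :
    ∀ (k : ℕ) (G : SimpleGraph (Fin (n₀ + k))), law S k G ≠ 0 →
      ∑ a, deg G a + 2 = 2 * (n₀ + k)
  | 0, G, h => by
      have : G = S := by by_contra hG; exact h (by simp [law, hG])
      subst this
      exact sum_deg_of_isTree hS
  | k + 1, G, h => by
      rw [law] at h
      obtain ⟨H, -, hH⟩ := exists_ne_zero_of_sum_ne_zero h
      obtain ⟨v, -, hv⟩ := exists_ne_zero_of_sum_ne_zero hH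
      have hG : attach H v = G := by by_contra hne; simp [hne] at hv
      have hl : law S k H ≠ 0 := fun h0 => by simp [h0] at hv
      have ih := sum_deg_of_law_ne_zero hS k H hl
      have := sum_deg_attach H v
      subst hG
      change ∑ a : Fin (n₀ + k + 1), deg (attach H v) a + 2 = _
      omega

lemma two_mul_sub_two_pos {n₀ : ℕ} (hn₀ : 2 ≤ n₀) (k : ℕ) :
    (0 : ℝ) < 2 * ((n₀ + k : ℕ) : ℝ) - 2 := by
  have : (2 : ℝ) ≤ n₀ := by exact_mod_cast hn₀
  have : (0 : ℝ) ≤ k := k.cast_nonneg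
  push_cast
  linarith

lemma law_nonneg {n₀ : ℕ} (S : SimpleGraph (Fin n₀)) (hn₀ : 2 ≤ n₀) :
    ∀ (k : ℕ) (G : SimpleGraph (Fin (n₀ + k))), 0 ≤ law S k G
  | 0, G => by rw [law]; split_ifs <;> norm_num
  | k + 1, G => by
      rw [law]
      have := (two_mul_sub_two_pos hn₀ k).le
      refine sum_nonneg fun H _ => sum_nonneg fun v _ => ?_
      have := law_nonneg S hn₀ k H
      split_ifs <;> positivity

/-- The expectation of `f` under the law after `k` steps. -/
def expect {n₀ : ℕ} (S : SimpleGraph (Fin n₀)) (k : ℕ)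
    (f : SimpleGraph (Fin (n₀ + k)) → ℝ) : ℝ :=
  ∑ G, law S k G * f G

lemma expect_succ {n₀ : ℕ} (S : SimpleGraph (Fin n₀)) (k : ℕ)
    (f : SimpleGraph (Fin (n₀ + k + 1)) → ℝ) :
    expect S (k + 1) f = expect S k fun H =>
      ∑ v, (deg H v : ℝ) / (2 * (n₀ + k : ℕ) - 2) * f (attach H v) := by
  simp only [expect, law, sum_mul, mul_sum]
  rw [sum_comm]
  refine sum_congr rfl fun H _ => ?_
  rw [sum_comm]
  refine sum_congr rfl fun v _ => ?_
  refine (sum_eq_single (attach H v) (fun G _ hG => ?_) (fun h => absurd (mem_univ _) h)).trans ?_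
  · simp [hG.symm]
  · simp only [if_true]; ring

lemma expect_mono {n₀ : ℕ} {S : SimpleGraph (Fin n₀)} (hS : S.IsTree) (hn₀ : 2 ≤ n₀) (k : ℕ)
    {f g : SimpleGraph (Fin (n₀ + k)) → ℝ}
    (h : ∀ G, ∑ a, deg G a + 2 = 2 * (n₀ + k) → f G ≤ g G) : expect S k f ≤ expect S k g := by
  refine sum_le_sum fun G _ => ?_
  by_cases hG : law S k G = 0
  · simp [hG]
  · exact mul_le_mul_of_nonneg_left (h G (sum_deg_of_law_ne_zero hS k G hG))
      (law_nonneg S hn₀ k G)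

lemma expect_sum {n₀ : ℕ} (S : SimpleGraph (Fin n₀)) (k : ℕ) {ι : Type*} (s : Finset ι)
    (f : ι → SimpleGraph (Fin (n₀ + k)) → ℝ) :
    expect S k (fun G => ∑ i ∈ s, f i G) = ∑ i ∈ s, expect S k (f i) := by
  simp only [expect, mul_sum]
  rw [sum_comm]

lemma expect_add {n₀ : ℕ} (S : SimpleGraph (Fin n₀)) (k : ℕ)
    (f g : SimpleGraph (Fin (n₀ + k)) → ℝ) :
    expect S k (fun G => f G + g G) = expect S k f + expect S k g := by
  simp only [expect, mul_add, sum_add_distrib]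

lemma expect_const_mul {n₀ : ℕ} (S : SimpleGraph (Fin n₀)) (k : ℕ) (c : ℝ)
    (f : SimpleGraph (Fin (n₀ + k)) → ℝ) :
    expect S k (fun G => c * f G) = c * expect S k f := by
  simp only [expect, mul_sum]
  exact sum_congr rfl fun _ _ => by ring

lemma expect_one {n₀ : ℕ} {S : SimpleGraph (Fin n₀)} (hS : S.IsTree) (hn₀ : 2 ≤ n₀) :
    ∀ k : ℕ, expect S k (fun _ => 1) ≤ 1
  | 0 => by simp [expect, law]
  | k + 1 => by
      refine le_trans (le_of_eq (expect_succ S k _)) (le_trans ?_ (expect_one hS hn₀ k))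
      refine expect_mono hS hn₀ k fun G hG => le_of_eq ?_
      have hD := two_mul_sub_two_pos hn₀ k
      have hG' : (∑ a, (deg G a : ℝ)) = 2 * ((n₀ + k : ℕ) : ℝ) - 2 := by
        rw [eq_sub_iff_add_eq]; exact_mod_cast hG
      simp only [mul_one, ← sum_div]
      rw [hG', div_self (ne_of_gt hD)]

/-- The weight of a map `φ` from a pattern (a relation `E` with labels `ℓ`) to the graph `T`:
the product of the rising factorials of the degrees if `φ` is an embedding, `0` otherwise. -/
def embWeight {W : Type} [Fintype W] {N : ℕ} (E : W → W → Prop) (ℓ : W → ℕ)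
    (T : SimpleGraph (Fin N)) (φ : W → Fin N) : ℝ :=
  if Function.Injective φ ∧ ∀ a b, E a b → T.Adj (φ a) (φ b) then
    ∏ u, ((deg T (φ u)).ascFactorial (ℓ u) : ℝ)
  else 0

/-- The total weight of all embeddings of a pattern. -/
def embSum {W : Type} [Fintype W] [DecidableEq W] {N : ℕ} (E : W → W → Prop) (ℓ : W → ℕ)
    (T : SimpleGraph (Fin N)) : ℝ :=
  ∑ φ : W → Fin N, embWeight E ℓ T φ

lemma embWeight_nonneg {W : Type} [Fintype W] {N : ℕ} (E : W → W → Prop) (ℓ : W → ℕ)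
    (T : SimpleGraph (Fin N)) (φ : W → Fin N) : 0 ≤ embWeight E ℓ T φ := by
  unfold embWeight
  split_ifs
  · exact prod_nonneg fun _ _ => Nat.cast_nonneg _
  · exact le_rfl

lemma embSum_nonneg {W : Type} [Fintype W] [DecidableEq W] {N : ℕ} (E : W → W → Prop) (ℓ : W → ℕ)
    (T : SimpleGraph (Fin N)) : 0 ≤ embSum E ℓ T :=
  sum_nonneg fun _ _ => embWeight_nonneg E ℓ T _

lemma embWeight_attach_eq {W : Type} [Fintype W] {N : ℕ} (E : W → W → Prop) (ℓ : W → ℕ)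
    (H : SimpleGraph (Fin N)) (v : Fin N) (φ : W → Fin N) :
    (deg H v : ℝ) * embWeight E ℓ (attach H v) (fun i => (φ i).castSucc)
      = embWeight E ℓ H φ * (deg H v + ∑ u, if φ u = v then (ℓ u : ℝ) else 0) := by
  have hinj : Function.Injective (fun i => (φ i).castSucc) ↔ Function.Injective φ :=
    (Fin.castSucc_injective N).of_comp_iff φ
  unfold embWeight
  simp only [attach_adj_castSucc, hinj]
  split_ifs with h
  swap
  · simp
  simp only [deg_attach_castSucc]
  by_cases hv : ∃ u₀, φ u₀ = v
  · obtain ⟨u₀, rfl⟩ := hv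
    have hne : ∀ u ∈ univ.erase u₀, φ u ≠ φ u₀ := fun u hu e => (ne_of_mem_erase hu) (h.1 e)
    have hkey : (deg H (φ u₀) : ℝ) * ((deg H (φ u₀) + 1).ascFactorial (ℓ u₀) : ℝ)
        = (deg H (φ u₀) + ℓ u₀) * ((deg H (φ u₀)).ascFactorial (ℓ u₀) : ℝ) := by
      exact_mod_cast Nat.succ_ascFactorial _ _
    rw [← mul_prod_erase univ _ (mem_univ u₀), ← mul_prod_erase univ _ (mem_univ u₀),
      ← add_sum_erase univ _ (mem_univ u₀),
      sum_eq_zero (s := univ.erase u₀) fun u hu => if_neg (hne u hu),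
      prod_congr (s₁ := univ.erase u₀) rfl fun u hu => by rw [if_neg (hne u hu), add_zero]]
    simp only [if_true]
    rw [← mul_assoc, hkey]
    ring
  · push Not at hv
    simp [hv, mul_comm]

lemma sum_embWeight_attach {W : Type} [Fintype W] {N : ℕ} (E : W → W → Prop) (ℓ : W → ℕ)
    (H : SimpleGraph (Fin N)) (φ : W → Fin N) {D : ℝ} (hD : 0 < D)
    (hH : ∑ a, (deg H a : ℝ) = D) :
    ∑ v, (deg H v : ℝ) / D * embWeight E ℓ (attach H v) (fun i => (φ i).castSucc)
      = (1 + (∑ u, ℓ u : ℕ) / D) * embWeight E ℓ H φ := by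
  have h1 : ∀ v, (deg H v : ℝ) / D * embWeight E ℓ (attach H v) (fun i => (φ i).castSucc)
      = embWeight E ℓ H φ * (deg H v + ∑ u, if φ u = v then (ℓ u : ℝ) else 0) / D := by
    intro v
    rw [← embWeight_attach_eq]
    ring
  simp only [h1]
  rw [← sum_div, ← mul_sum, sum_add_distrib, hH, sum_comm]
  simp only [sum_ite_eq, mem_univ, if_true]
  push_cast
  field_simp

lemma deg_mul_embWeight_attach {W : Type} [Fintype W] [DecidableEq W] {N : ℕ} (E : W → W → Prop) (ℓ : W → ℕ)
    (H : SimpleGraph (Fin N)) (φ : W → Fin N) (b : W) :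
    (deg H (φ b) : ℝ) * embWeight E ℓ (attach H (φ b)) (fun i => (φ i).castSucc)
      = embWeight E (fun i => ℓ i + if i = b then 1 else 0) H φ := by
  rw [embWeight_attach_eq]
  unfold embWeight
  split_ifs with h
  swap
  · simp
  have hrest : ∏ u ∈ univ.erase b, ((deg H (φ u)).ascFactorial (ℓ u + if u = b then 1 else 0) : ℝ)
      = ∏ u ∈ univ.erase b, ((deg H (φ u)).ascFactorial (ℓ u) : ℝ) :=
    prod_congr rfl fun u hu => by rw [if_neg (ne_of_mem_erase hu), add_zero]
  rw [← mul_prod_erase univ _ (mem_univ b), ← mul_prod_erase univ _ (mem_univ b), hrest]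
  simp only [h.1.eq_iff, sum_ite_eq', mem_univ, if_true, Nat.ascFactorial_succ]
  push_cast
  ring

/-- Extension of a map into `Fin N` sending one further vertex to the last element. -/
def extendLast {m N : ℕ} (u : Fin (m + 1)) (φ : Fin m → Fin N) : Fin (m + 1) → Fin (N + 1) :=
  Fin.insertNth (α := fun _ => Fin (N + 1)) u (Fin.last N) fun i => (φ i).castSucc

lemma extendLast_same {m N : ℕ} (u : Fin (m + 1)) (φ : Fin m → Fin N) :
    extendLast u φ u = Fin.last N :=
  Fin.insertNth_apply_same (α := fun _ => Fin (N + 1)) _ _ _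

lemma extendLast_succAbove {m N : ℕ} (u : Fin (m + 1)) (φ : Fin m → Fin N) (i : Fin m) :
    extendLast u φ (u.succAbove i) = (φ i).castSucc :=
  Fin.insertNth_apply_succAbove (α := fun _ => Fin (N + 1)) _ _ _ _

lemma embWeight_extendLast_le {m N : ℕ} (E : Fin (m + 1) → Fin (m + 1) → Prop)
    (ℓ : Fin (m + 1) → ℕ) (H : SimpleGraph (Fin N)) (v : Fin N) (u : Fin (m + 1))
    (φ : Fin m → Fin N) :
    embWeight E ℓ (attach H v) (extendLast u φ) ≤ (ℓ u).factorial *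
      embWeight (fun a b => E (u.succAbove a) (u.succAbove b)) (fun i => ℓ (u.succAbove i))
        (attach H v) (fun i => (φ i).castSucc) := by
  by_cases h : Function.Injective (extendLast u φ) ∧
      ∀ a b, E a b → (attach H v).Adj (extendLast u φ a) (extendLast u φ b)
  · have h' : Function.Injective (fun i => (φ i).castSucc) ∧
        ∀ a b, E (u.succAbove a) (u.succAbove b) →
          (attach H v).Adj ((φ a).castSucc) ((φ b).castSucc) := by
      refine ⟨fun a b hab => ?_, fun a b hab => ?_⟩
      · refine Fin.succAbove_right_injective (p := u) (h.1 ?_)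
        simpa only [extendLast_succAbove] using hab
      · simpa only [extendLast_succAbove] using h.2 _ _ hab
    rw [embWeight, embWeight, if_pos h, if_pos h', Fin.prod_univ_succAbove _ u]
    simp only [extendLast_same, extendLast_succAbove, deg_attach_last, Nat.one_ascFactorial]
    exact le_rfl
  · rw [embWeight, if_neg h]
    exact mul_nonneg (Nat.cast_nonneg _) (embWeight_nonneg _ _ _ _)

lemma embWeight_extendLast_eq_zero {m N : ℕ} {E : Fin (m + 1) → Fin (m + 1) → Prop}
    (ℓ : Fin (m + 1) → ℕ) (H : SimpleGraph (Fin N)) {v : Fin N} {u : Fin (m + 1)}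
    {φ : Fin m → Fin N} {b : Fin m} (hb : E u (u.succAbove b) ∨ E (u.succAbove b) u)
    (hv : φ b ≠ v) : embWeight E ℓ (attach H v) (extendLast u φ) = 0 := by
  rw [embWeight, if_neg]
  rintro ⟨-, h⟩
  rcases hb with hb | hb
  · have := h _ _ hb
    rw [extendLast_same, extendLast_succAbove, attach_adj_last] at this
    exact hv this
  · have := (h _ _ hb).symm
    rw [extendLast_same, extendLast_succAbove, attach_adj_last] at this
    exact hv this

/-- A sum is bounded by any parametrized sum of nonnegative terms dominating its support. -/
lemma sum_le_sum_of_cover {α ι : Type*} [Fintype α] [Fintype ι] (g : α → ℝ) (h : ι → ℝ)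
    (hh : ∀ i, 0 ≤ h i) (F : ι → α) (hF : ∀ a, g a ≠ 0 → ∃ i, F i = a ∧ g a ≤ h i) :
    ∑ a, g a ≤ ∑ i, h i := by
  rw [← sum_fiberwise univ F h]
  refine sum_le_sum fun a _ => ?_
  by_cases ha : g a = 0
  · rw [ha]
    exact sum_nonneg fun i _ => hh i
  · obtain ⟨i, hi, hle⟩ := hF a ha
    exact hle.trans (single_le_sum (fun j _ => hh j) (by simpa using hi))

lemma embSum_attach_le {m N : ℕ} (E : Fin (m + 1) → Fin (m + 1) → Prop) (ℓ : Fin (m + 1) → ℕ)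
    (G : SimpleGraph (Fin (N + 1))) :
    embSum E ℓ G ≤ ∑ φ : Fin (m + 1) → Fin N, embWeight E ℓ G (fun i => (φ i).castSucc)
      + ∑ u : Fin (m + 1), ∑ φ : Fin m → Fin N, embWeight E ℓ G (extendLast u φ) := by
  let F : (Fin (m + 1) → Fin N) ⊕ (Fin (m + 1) × (Fin m → Fin N)) → Fin (m + 1) → Fin (N + 1) :=
    Sum.elim (fun φ i => (φ i).castSucc) (fun p => extendLast p.1 p.2)
  have h := sum_le_sum_of_cover (embWeight E ℓ G) (fun i => embWeight E ℓ G (F i))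
    (fun _ => embWeight_nonneg E ℓ G _) F ?_
  · simpa only [Fintype.sum_sum_type, Sum.elim_inl, Sum.elim_inr, Fintype.sum_prod_type, embSum, F]
      using h
  intro φ hφ
  suffices ∃ i, F i = φ from this.imp fun i hi => ⟨hi, by rw [hi]⟩
  have hinj : Function.Injective φ := by
    by_contra hn
    exact hφ (by rw [embWeight, if_neg fun h => hn h.1])
  by_cases hu : ∃ u, φ u = Fin.last N
  · obtain ⟨u, hu⟩ := hu
    have hne : ∀ i, φ (u.succAbove i) ≠ Fin.last N := fun i e =>
      Fin.succAbove_ne u i (hinj (e.trans hu.symm))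
    refine ⟨Sum.inr (u, fun i => (φ (u.succAbove i)).castPred (hne i)), ?_⟩
    funext x
    simp only [F, Sum.elim_inr]
    rcases Fin.eq_self_or_eq_succAbove u x with rfl | ⟨j, rfl⟩
    · rw [extendLast_same, hu]
    · rw [extendLast_succAbove, Fin.castSucc_castPred]
  · push Not at hu
    exact ⟨Sum.inl fun i => (φ i).castPred (hu i), by simp [F]⟩

lemma rpow_growth_step {s M L L' a C K : ℝ} (hs : 1 ≤ s) (hM : 1 ≤ M) (m : ℕ) (hL : 1 ≤ L)
    (hL' : L + 1 / (M + 1) ≤ L') (hC : C ≤ K) (hK : 0 ≤ K) (ha : a ≤ K * M ^ s * L ^ (m + 1)) :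
    (1 + s / M) * a + C * M ^ (s - 1) * L ^ m ≤ K * (M + 1) ^ s * L' ^ (m + 1) := by
  have hM0 : 0 < M := by linarith
  have hL0 : 0 < L := by linarith
  have hbern : M ^ s * (1 + s / M) ≤ (M + 1) ^ s := by
    have h1 : 1 + s * (1 / M) ≤ (1 + 1 / M) ^ s :=
      one_add_mul_self_le_rpow_one_add (by have : 0 < 1 / M := by positivity
                                           linarith) hs
    calc M ^ s * (1 + s / M) = M ^ s * (1 + s * (1 / M)) := by ring
      _ ≤ M ^ s * (1 + 1 / M) ^ s := by gcongr
      _ = (M + 1) ^ s := by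
        rw [← Real.mul_rpow hM0.le (by positivity)]
        congr 1
        field_simp
  have hpow : M ^ (s - 1) ≤ (M + 1) ^ s * (1 / (M + 1)) := by
    calc M ^ (s - 1) ≤ (M + 1) ^ (s - 1) :=
          Real.rpow_le_rpow hM0.le (by linarith) (by linarith)
      _ = (M + 1) ^ s * (1 / (M + 1)) := by
          rw [Real.rpow_sub_one (by linarith)]; ring
  have hLpow : L ^ (m + 1) + 1 / (M + 1) * L ^ m ≤ L' ^ (m + 1) := by
    have hi : 0 < 1 / (M + 1) := by positivity
    calc L ^ (m + 1) + 1 / (M + 1) * L ^ m = (L + 1 / (M + 1)) * L ^ m := by ring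
      _ ≤ L' * L' ^ m := by gcongr <;> linarith
      _ = L' ^ (m + 1) := by ring
  have hs0 : 0 ≤ 1 + s / M := by positivity
  calc (1 + s / M) * a + C * M ^ (s - 1) * L ^ m
      ≤ (1 + s / M) * (K * M ^ s * L ^ (m + 1)) + K * M ^ (s - 1) * L ^ m := by gcongr
    _ = K * (M ^ s * (1 + s / M)) * L ^ (m + 1) + K * M ^ (s - 1) * L ^ m := by ring
    _ ≤ K * (M + 1) ^ s * L ^ (m + 1) + K * ((M + 1) ^ s * (1 / (M + 1))) * L ^ m := by gcongr
    _ = K * (M + 1) ^ s * (L ^ (m + 1) + 1 / (M + 1) * L ^ m) := by ring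
    _ ≤ K * (M + 1) ^ s * L' ^ (m + 1) := by gcongr

lemma rpow_log_bound_of_recurrence {s M₀ C : ℝ} (hs : 1 ≤ s) (hM₀ : 1 ≤ M₀) (m : ℕ) (hC : 0 ≤ C)
    (a : ℕ → ℝ)
    (h : ∀ k : ℕ, a (k + 1) ≤ (1 + s / (M₀ + k)) * a k
      + C * (M₀ + k) ^ (s - 1) * (1 + Real.log (M₀ + k)) ^ m) :
    ∃ K : ℝ, 0 ≤ K ∧ ∀ k : ℕ, a k ≤ K * (M₀ + k) ^ s * (1 + Real.log (M₀ + k)) ^ (m + 1) := by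
  have hK : 0 ≤ max C |a 0| := le_max_of_le_left hC
  refine ⟨max C |a 0|, hK, fun k => ?_⟩
  induction k with
  | zero =>
    have h1 : (1 : ℝ) ≤ M₀ ^ s := Real.one_le_rpow hM₀ (by linarith)
    have h2 : (1 : ℝ) ≤ (1 + Real.log M₀) ^ (m + 1) :=
      one_le_pow₀ (by have := Real.log_nonneg hM₀; linarith)
    simp only [Nat.cast_zero, add_zero]
    calc a 0 ≤ max C |a 0| := (le_abs_self _).trans (le_max_right _ _)
      _ ≤ max C |a 0| * M₀ ^ s := le_mul_of_one_le_right hK h1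
      _ ≤ max C |a 0| * M₀ ^ s * (1 + Real.log M₀) ^ (m + 1) :=
        le_mul_of_one_le_right (by positivity) h2
  | succ k ih =>
    have hM : 1 ≤ M₀ + k := by
      have : (0 : ℝ) ≤ k := k.cast_nonneg
      linarith
    refine (h k).trans ?_
    push_cast
    rw [← add_assoc]
    refine rpow_growth_step hs hM m ?_ ?_ (le_max_left _ _) hK ih
    · have := Real.log_nonneg hM
      linarith
    · have hpos : 0 < M₀ + k := by linarith
      have h1 := Real.one_sub_inv_le_log_of_pos (x := (M₀ + k + 1) / (M₀ + k)) (by positivity)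
      rw [Real.log_div (by positivity) (by positivity)] at h1
      have h2 : 1 - ((M₀ + k + 1) / (M₀ + k))⁻¹ = 1 / (M₀ + k + 1) := by
        field_simp
        ring
      linarith

/-- The patterns with positive labels in which every vertex with label `1` has a neighbour. -/
def IsHeavy {W : Type} (E : W → W → Prop) (ℓ : W → ℕ) : Prop :=
  ∀ u, 1 ≤ ℓ u ∧ (2 ≤ ℓ u ∨ ∃ b, b ≠ u ∧ (E u b ∨ E b u))

lemma IsHeavy.two_le_sum {m : ℕ} {E : Fin (m + 1) → Fin (m + 1) → Prop} {ℓ : Fin (m + 1) → ℕ}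
    (h : IsHeavy E ℓ) : 2 ≤ ∑ u, ℓ u := by
  rcases (h 0).2 with h0 | ⟨b, hb, -⟩
  · exact h0.trans (single_le_sum_of_canonicallyOrdered (mem_univ 0))
  · calc 2 ≤ ∑ u ∈ {b, 0}, ℓ u := by
          rw [sum_pair hb]
          exact add_le_add (h b).1 (h 0).1
      _ ≤ ∑ u, ℓ u := sum_le_sum_of_subset (subset_univ _)

/-- The contribution of the embeddings mapping `u` to the vertex created at the next step. -/
def leafSum {m N : ℕ} (E : Fin (m + 1) → Fin (m + 1) → Prop) (ℓ : Fin (m + 1) → ℕ)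
    (u : Fin (m + 1)) (D : ℝ) (H : SimpleGraph (Fin N)) : ℝ :=
  ∑ φ : Fin m → Fin N, ∑ v, (deg H v : ℝ) / D * embWeight E ℓ (attach H v) (extendLast u φ)

lemma sum_deg_mul_embSum_attach_le {m N : ℕ} (E : Fin (m + 1) → Fin (m + 1) → Prop)
    (ℓ : Fin (m + 1) → ℕ) (H : SimpleGraph (Fin N)) {D : ℝ} (hD : 0 < D)
    (hH : ∑ a, (deg H a : ℝ) = D) :
    ∑ v, (deg H v : ℝ) / D * embSum E ℓ (attach H v)
      ≤ (1 + (∑ u, ℓ u : ℕ) / D) * embSum E ℓ H + ∑ u, leafSum E ℓ u D H := by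
  calc ∑ v, (deg H v : ℝ) / D * embSum E ℓ (attach H v)
      ≤ ∑ v, (deg H v : ℝ) / D *
          (∑ φ : Fin (m + 1) → Fin N, embWeight E ℓ (attach H v) (fun i => (φ i).castSucc)
          + ∑ u, ∑ φ : Fin m → Fin N, embWeight E ℓ (attach H v) (extendLast u φ)) :=
        sum_le_sum fun v _ => mul_le_mul_of_nonneg_left (embSum_attach_le E ℓ _) (by positivity)
    _ = _ := by
      simp only [mul_add, sum_add_distrib, mul_sum, embSum, leafSum]
      congr 1
      · rw [sum_comm]
        exact sum_congr rfl fun φ _ => sum_embWeight_attach E ℓ H φ hD hH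
      · rw [sum_comm]
        exact sum_congr rfl fun u _ => sum_comm

lemma leafSum_le {m N : ℕ} (E : Fin (m + 1) → Fin (m + 1) → Prop) (ℓ : Fin (m + 1) → ℕ)
    (u : Fin (m + 1)) (H : SimpleGraph (Fin N)) {D : ℝ} (hD : 0 < D)
    (hH : ∑ a, (deg H a : ℝ) = D) :
    leafSum E ℓ u D H ≤ (ℓ u).factorial * (1 + (∑ i, ℓ (u.succAbove i) : ℕ) / D) *
      embSum (fun a b => E (u.succAbove a) (u.succAbove b)) (fun i => ℓ (u.succAbove i)) H := by
  rw [leafSum, embSum, mul_sum]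
  refine sum_le_sum fun φ _ => ?_
  rw [mul_assoc, ← sum_embWeight_attach _ _ H φ hD hH, mul_sum]
  refine sum_le_sum fun v _ => ?_
  rw [mul_left_comm]
  exact mul_le_mul_of_nonneg_left (embWeight_extendLast_le E ℓ H v u φ) (by positivity)

lemma leafSum_le_of_adj {m N : ℕ} {E : Fin (m + 1) → Fin (m + 1) → Prop} (ℓ : Fin (m + 1) → ℕ)
    {u : Fin (m + 1)} {b : Fin m} (hb : E u (u.succAbove b) ∨ E (u.succAbove b) u)
    (H : SimpleGraph (Fin N)) {D : ℝ} (hD : 0 < D) :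
    leafSum E ℓ u D H ≤ (ℓ u).factorial / D *
      embSum (fun a b => E (u.succAbove a) (u.succAbove b))
        (fun i => ℓ (u.succAbove i) + if i = b then 1 else 0) H := by
  rw [leafSum, embSum, mul_sum]
  refine sum_le_sum fun φ _ => ?_
  rw [← deg_mul_embWeight_attach, sum_eq_single (φ b)]
  · calc _ ≤ (deg H (φ b) : ℝ) / D * _ :=
          mul_le_mul_of_nonneg_left (embWeight_extendLast_le E ℓ H (φ b) u φ) (by positivity)
      _ = _ := by ring
  · intro v _ hv
    rw [embWeight_extendLast_eq_zero ℓ H hb hv.symm, mul_zero]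
  · exact fun h => absurd (mem_univ _) h

lemma leafSum_eq_zero {m N : ℕ} {E : Fin (m + 1) → Fin (m + 1) → Prop} (ℓ : Fin (m + 1) → ℕ)
    {u : Fin (m + 1)} {b c : Fin m} (hb : E u (u.succAbove b) ∨ E (u.succAbove b) u)
    (hc : E u (u.succAbove c) ∨ E (u.succAbove c) u) (hbc : b ≠ c)
    (H : SimpleGraph (Fin N)) (D : ℝ) : leafSum E ℓ u D H = 0 := by
  refine sum_eq_zero fun φ _ => sum_eq_zero fun v _ => ?_
  by_cases h1 : φ b = v
  · by_cases h2 : φ c = v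
    · rw [embWeight, if_neg, mul_zero]
      rintro ⟨hinj, -⟩
      refine hbc (Fin.succAbove_right_injective (p := u) (hinj ?_))
      rw [extendLast_succAbove, extendLast_succAbove, h1, h2]
    · rw [embWeight_extendLast_eq_zero ℓ H hc h2, mul_zero]
  · rw [embWeight_extendLast_eq_zero ℓ H hb h1, mul_zero]

lemma IsHeavy.delete_isolated {m : ℕ} {E : Fin (m + 1) → Fin (m + 1) → Prop}
    {ℓ : Fin (m + 1) → ℕ} (h : IsHeavy E ℓ) {u : Fin (m + 1)}
    (hu : ¬ ∃ b : Fin m, E u (u.succAbove b) ∨ E (u.succAbove b) u) :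
    IsHeavy (fun a b => E (u.succAbove a) (u.succAbove b)) (fun i => ℓ (u.succAbove i)) := by
  intro i
  refine ⟨(h _).1, (h (u.succAbove i)).2.imp id ?_⟩
  rintro ⟨b, hbi, hE⟩
  rcases Fin.eq_self_or_eq_succAbove u b with rfl | ⟨j, rfl⟩
  · exact absurd ⟨i, hE.symm⟩ hu
  · exact ⟨j, fun e => hbi (by rw [e]), hE⟩

lemma IsHeavy.delete_leaf {m : ℕ} {E : Fin (m + 1) → Fin (m + 1) → Prop}
    {ℓ : Fin (m + 1) → ℕ} (h : IsHeavy E ℓ) {u : Fin (m + 1)} {b : Fin m}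
    (hu : ∀ c : Fin m, (E u (u.succAbove c) ∨ E (u.succAbove c) u) → b = c) :
    IsHeavy (fun a b => E (u.succAbove a) (u.succAbove b))
      (fun i => ℓ (u.succAbove i) + if i = b then 1 else 0) := by
  intro i
  have h1 := (h (u.succAbove i)).1
  refine ⟨Nat.le_add_right_of_le h1, ?_⟩
  beta_reduce
  by_cases hi : i = b
  · left
    rw [if_pos hi]
    omega
  · rw [if_neg hi, add_zero]
    refine (h (u.succAbove i)).2.imp id ?_
    rintro ⟨c, hci, hE⟩
    rcases Fin.eq_self_or_eq_succAbove u c with rfl | ⟨j, rfl⟩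
    · exact absurd (hu i hE.symm).symm hi
    · exact ⟨j, fun e => hci (by rw [e]), hE⟩

/-- The bound on the mean number of embeddings of a pattern, as a function of the step. -/
def HasMeanBound {n₀ : ℕ} (S : SimpleGraph (Fin n₀)) {m : ℕ} (E : Fin m → Fin m → Prop)
    (ℓ : Fin m → ℕ) : Prop :=
  ∃ C : ℝ, 0 ≤ C ∧ ∀ k : ℕ, expect S k (embSum E ℓ) ≤
    C * ((n₀ : ℝ) - 1 + k) ^ (((∑ u, ℓ u : ℕ) : ℝ) / 2) * (1 + Real.log ((n₀ : ℝ) - 1 + k)) ^ m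

lemma sum_deg_eq_two_mul {n₀ k : ℕ} {G : SimpleGraph (Fin (n₀ + k))}
    (hG : ∑ a, deg G a + 2 = 2 * (n₀ + k)) :
    ∑ a, (deg G a : ℝ) = 2 * ((n₀ : ℝ) - 1 + k) := by
  have : (∑ a, (deg G a : ℝ)) + 2 = 2 * (n₀ + k) := by exact_mod_cast hG
  linarith

lemma expect_leafSum_le {n₀ : ℕ} {S : SimpleGraph (Fin n₀)} (hS : S.IsTree) (hn₀ : 2 ≤ n₀)
    {m : ℕ} (ih : ∀ (E : Fin m → Fin m → Prop) (ℓ : Fin m → ℕ), IsHeavy E ℓ → HasMeanBound S E ℓ)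
    {E : Fin (m + 1) → Fin (m + 1) → Prop} {ℓ : Fin (m + 1) → ℕ} (h : IsHeavy E ℓ)
    (u : Fin (m + 1)) :
    ∃ C : ℝ, 0 ≤ C ∧ ∀ k : ℕ,
      expect S k (leafSum E ℓ u (2 * ((n₀ : ℝ) - 1 + k))) ≤
        C * ((n₀ : ℝ) - 1 + k) ^ (((∑ u, ℓ u : ℕ) : ℝ) / 2 - 1)
          * (1 + Real.log ((n₀ : ℝ) - 1 + k)) ^ m := by
  have hM : ∀ k : ℕ, (1 : ℝ) ≤ (n₀ : ℝ) - 1 + k := fun k => by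
    have h1 : (2 : ℝ) ≤ n₀ := by exact_mod_cast hn₀
    have h2 : (0 : ℝ) ≤ k := k.cast_nonneg
    linarith
  have hL : ∀ k : ℕ, (0 : ℝ) ≤ 1 + Real.log ((n₀ : ℝ) - 1 + k) := fun k => by
    have := Real.log_nonneg (hM k)
    linarith
  by_cases hu : ∃ b : Fin m, E u (u.succAbove b) ∨ E (u.succAbove b) u
  · obtain ⟨b, hb⟩ := hu
    by_cases hc : ∃ c : Fin m, (E u (u.succAbove c) ∨ E (u.succAbove c) u) ∧ b ≠ c
    · obtain ⟨c, hc, hbc⟩ := hc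
      exact ⟨0, le_rfl, fun k => by simp [expect, leafSum_eq_zero ℓ hb hc hbc]⟩
    · push Not at hc
      obtain ⟨C, hC, hbd⟩ := ih _ _ (h.delete_leaf hc)
      refine ⟨(ℓ u).factorial * C, by positivity, fun k => ?_⟩
      have hMk := hM k
      have hLk := hL k
      have hbdk := hbd k
      set M : ℝ := (n₀ : ℝ) - 1 + k
      have hw : ((∑ i, (ℓ (u.succAbove i) + if i = b then 1 else 0) : ℕ) : ℝ)
          ≤ ((∑ i, ℓ i : ℕ) : ℝ) := by
        have := (h u).1
        rw [Fin.sum_univ_succAbove _ u, sum_add_distrib]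
        simp only [sum_ite_eq', mem_univ, if_true]
        exact_mod_cast (by omega)
      calc expect S k (leafSum E ℓ u (2 * M))
          ≤ (ℓ u).factorial / (2 * M) * expect S k
              (embSum (fun a b => E (u.succAbove a) (u.succAbove b))
                (fun i => ℓ (u.succAbove i) + if i = b then 1 else 0)) := by
            rw [← expect_const_mul]
            exact expect_mono hS hn₀ k fun G _ => leafSum_le_of_adj ℓ hb G (by linarith)
        _ ≤ (ℓ u).factorial / M *
              (C * M ^ (((∑ i, ℓ i : ℕ) : ℝ) / 2) * (1 + Real.log M) ^ m) := by
            have hM0 : 0 < M := by linarith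
            refine mul_le_mul ?_ (hbdk.trans ?_) ?_ (by positivity)
            · gcongr
              linarith
            · gcongr
            · exact sum_nonneg fun G _ => mul_nonneg (law_nonneg S hn₀ k G) (embSum_nonneg _ _ _)
        _ = _ := by
            rw [Real.rpow_sub_one (by linarith)]
            ring
  · obtain ⟨C, hC, hbd⟩ := ih _ _ (h.delete_isolated hu)
    have h2 : 2 ≤ ℓ u := by
      rcases (h u).2 with h2 | ⟨b, hbu, hE⟩
      · exact h2
      · obtain ⟨j, rfl⟩ := Fin.exists_succAbove_eq hbu
        exact absurd ⟨j, hE⟩ hu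
    refine ⟨(ℓ u).factorial * (1 + (∑ i, ℓ (u.succAbove i) : ℕ)) * C, by positivity, fun k => ?_⟩
    have hMk := hM k
    have hLk := hL k
    have hbdk := hbd k
    have hsum : ∀ G : SimpleGraph (Fin (n₀ + k)), ∑ a, deg G a + 2 = 2 * (n₀ + k) → _ :=
      fun G hG => sum_deg_eq_two_mul hG
    set M : ℝ := (n₀ : ℝ) - 1 + k
    have hw : ((∑ i, ℓ (u.succAbove i) : ℕ) : ℝ) / 2 ≤ ((∑ i, ℓ i : ℕ) : ℝ) / 2 - 1 := by
      rw [Fin.sum_univ_succAbove _ u]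
      have : (2 : ℝ) ≤ ℓ u := by exact_mod_cast h2
      push_cast
      linarith
    calc expect S k (leafSum E ℓ u (2 * M))
        ≤ (ℓ u).factorial * (1 + (∑ i, ℓ (u.succAbove i) : ℕ) / (2 * M)) * expect S k
            (embSum (fun a b => E (u.succAbove a) (u.succAbove b))
              (fun i => ℓ (u.succAbove i))) := by
          rw [← expect_const_mul]
          exact expect_mono hS hn₀ k fun G hG => leafSum_le E ℓ u G (by linarith) (hsum G hG)
      _ ≤ (ℓ u).factorial * (1 + (∑ i, ℓ (u.succAbove i) : ℕ)) *
            (C * M ^ (((∑ i, ℓ i : ℕ) : ℝ) / 2 - 1) * (1 + Real.log M) ^ m) := by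
          refine mul_le_mul ?_ (hbdk.trans ?_) ?_ (by positivity)
          · gcongr
            exact div_le_self (Nat.cast_nonneg _) (by linarith)
          · gcongr
          · exact sum_nonneg fun G _ => mul_nonneg (law_nonneg S hn₀ k G) (embSum_nonneg _ _ _)
      _ = _ := by ring

lemma hasMeanBound {n₀ : ℕ} {S : SimpleGraph (Fin n₀)} (hS : S.IsTree) (hn₀ : 2 ≤ n₀) :
    ∀ {m : ℕ} (E : Fin m → Fin m → Prop) (ℓ : Fin m → ℕ), IsHeavy E ℓ → HasMeanBound S E ℓ := by
  intro m
  induction m with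
  | zero =>
    intro E ℓ _
    refine ⟨1, zero_le_one, fun k => ?_⟩
    have h1 : ∀ G : SimpleGraph (Fin (n₀ + k)), embSum E ℓ G ≤ 1 := fun G => by
      rw [embSum, Fintype.sum_unique, embWeight]
      split_ifs <;> simp
    simpa using (expect_mono hS hn₀ k fun G _ => h1 G).trans (expect_one hS hn₀ k)
  | succ m ih =>
    intro E ℓ h
    choose C hC hbd using fun u => expect_leafSum_le hS hn₀ ih h u
    have hw : (1 : ℝ) ≤ ((∑ u, ℓ u : ℕ) : ℝ) / 2 := by
      have : (2 : ℝ) ≤ ((∑ u, ℓ u : ℕ) : ℝ) := by exact_mod_cast h.two_le_sum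
      linarith
    have hM₀ : (1 : ℝ) ≤ (n₀ : ℝ) - 1 := by
      have : (2 : ℝ) ≤ n₀ := by exact_mod_cast hn₀
      linarith
    refine rpow_log_bound_of_recurrence (C := ∑ u, C u) hw hM₀ m (sum_nonneg fun u _ => hC u)
      (fun k => expect S k (embSum E ℓ)) fun k => ?_
    have hMk : (1 : ℝ) ≤ (n₀ : ℝ) - 1 + k := by
      have : (0 : ℝ) ≤ k := k.cast_nonneg
      linarith
    have hD : (2 * ((n₀ + k : ℕ) : ℝ) - 2) = 2 * ((n₀ : ℝ) - 1 + k) := by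
      push_cast
      ring
    refine (expect_succ S k (embSum E ℓ)).trans_le ?_
    simp only [hD]
    refine (expect_mono hS hn₀ k fun G hG =>
      sum_deg_mul_embSum_attach_le E ℓ G (by linarith) (sum_deg_eq_two_mul hG)).trans ?_
    rw [expect_add, expect_const_mul, expect_sum, sum_mul, sum_mul]
    refine add_le_add (le_of_eq ?_) (sum_le_sum fun u _ => hbd u k)
    congr 2
    rw [div_div]

/-- The weight of a map from a pattern to `T`: the product of the rising factorials of the
degrees if the map preserves the relation, `0` otherwise. -/
def homWeight {W : Type} [Fintype W] {N : ℕ} (E : W → W → Prop) (ℓ : W → ℕ)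
    (T : SimpleGraph (Fin N)) (ψ : W → Fin N) : ℝ :=
  if ∀ a b, E a b → T.Adj (ψ a) (ψ b) then ∏ u, ((deg T (ψ u)).ascFactorial (ℓ u) : ℝ) else 0

lemma homWeight_nonneg {W : Type} [Fintype W] {N : ℕ} (E : W → W → Prop) (ℓ : W → ℕ)
    (T : SimpleGraph (Fin N)) (ψ : W → Fin N) : 0 ≤ homWeight E ℓ T ψ := by
  unfold homWeight
  split_ifs
  · exact prod_nonneg fun _ _ => Nat.cast_nonneg _
  · exact le_rfl

lemma homWeight_sumElim {V W : Type} [Fintype V] [Fintype W] {N : ℕ} (E : V → V → Prop)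
    (E' : W → W → Prop) (ℓ : V → ℕ) (ℓ' : W → ℕ) (T : SimpleGraph (Fin N)) (φ : V → Fin N)
    (φ' : W → Fin N) :
    homWeight (Sum.LiftRel E E') (Sum.elim ℓ ℓ') T (Sum.elim φ φ')
      = homWeight E ℓ T φ * homWeight E' ℓ' T φ' := by
  unfold homWeight
  by_cases h : ∀ a b, E a b → T.Adj (φ a) (φ b)
  · by_cases h' : ∀ a b, E' a b → T.Adj (φ' a) (φ' b)
    · rw [if_pos h, if_pos h', if_pos, Fintype.prod_sum_type]
      · rfl
      · rintro _ _ (⟨hab⟩ | ⟨hab⟩)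
        · exact h _ _ hab
        · exact h' _ _ hab
    · rw [if_neg h', mul_zero, if_neg]
      exact fun H => h' fun a b hab => H (Sum.inr a) (Sum.inr b) (Sum.LiftRel.inr hab)
  · rw [if_neg h, zero_mul, if_neg]
    exact fun H => h fun a b hab => H (Sum.inl a) (Sum.inl b) (Sum.LiftRel.inl hab)

/-- The image of a relation under a map. -/
def pushRel {W : Type} {p : ℕ} (σ : W → Fin p) (E : W → W → Prop) (x y : Fin p) : Prop :=
  ∃ a b, σ a = x ∧ σ b = y ∧ E a b

/-- The image of labels under a map, adding the labels over each fibre. -/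
def pushLabel {W : Type} [Fintype W] {p : ℕ} (σ : W → Fin p) (ℓ : W → ℕ) (x : Fin p) : ℕ :=
  ∑ a with σ a = x, ℓ a

lemma sum_pushLabel {W : Type} [Fintype W] {p : ℕ} (σ : W → Fin p) (ℓ : W → ℕ) :
    ∑ x, pushLabel σ ℓ x = ∑ a, ℓ a :=
  sum_fiberwise univ σ ℓ

lemma IsHeavy.push {W : Type} [Fintype W] {p : ℕ} {E : W → W → Prop} {ℓ : W → ℕ}
    (h : IsHeavy E ℓ) {σ : W → Fin p} (hσ : Function.Surjective σ) :
    IsHeavy (pushRel σ E) (pushLabel σ ℓ) := by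
  intro x
  obtain ⟨a, rfl⟩ := hσ x
  have ha : ℓ a ≤ pushLabel σ ℓ (σ a) :=
    single_le_sum_of_canonicallyOrdered (f := ℓ) (mem_filter.2 ⟨mem_univ a, rfl⟩)
  refine ⟨(h a).1.trans ha, ?_⟩
  rcases (h a).2 with h2 | ⟨b, hba, hE⟩
  · exact Or.inl (h2.trans ha)
  · by_cases hs : σ b = σ a
    · left
      calc 2 ≤ ∑ c ∈ {b, a}, ℓ c := by
            rw [sum_pair hba]
            exact add_le_add (h b).1 (h a).1
        _ ≤ pushLabel σ ℓ (σ a) := sum_le_sum_of_subset (by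
            intro c hc
            rcases mem_insert.1 hc with rfl | hc
            · simpa using hs
            · simp [mem_singleton.1 hc])
    · exact Or.inr ⟨σ b, hs, hE.imp (fun e => ⟨a, b, rfl, rfl, e⟩) fun e => ⟨b, a, rfl, rfl, e⟩⟩

lemma prod_ascFactorial_le {W : Type} (s : Finset W) (d : ℕ) (ℓ : W → ℕ) :
    ∏ a ∈ s, d.ascFactorial (ℓ a) ≤ d.ascFactorial (∑ a ∈ s, ℓ a) := by
  induction s using Finset.induction_on with
  | empty => simp
  | insert a s ha ih =>
    rw [prod_insert ha, sum_insert ha, ← Nat.ascFactorial_mul_ascFactorial]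
    exact Nat.mul_le_mul_left _ (ih.trans (Nat.ascFactorial_le _ (Nat.le_add_right _ _)))

lemma homWeight_comp_le {W : Type} [Fintype W] {N p : ℕ} (E : W → W → Prop) (ℓ : W → ℕ)
    (T : SimpleGraph (Fin N)) (σ : W → Fin p) {φ : Fin p → Fin N} (hφ : Function.Injective φ) :
    homWeight E ℓ T (φ ∘ σ) ≤ embWeight (pushRel σ E) (pushLabel σ ℓ) T φ := by
  by_cases h : ∀ a b, E a b → T.Adj ((φ ∘ σ) a) ((φ ∘ σ) b)
  · have h' : Function.Injective φ ∧ ∀ x y, pushRel σ E x y → T.Adj (φ x) (φ y) := by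
      refine ⟨hφ, ?_⟩
      rintro _ _ ⟨a, b, rfl, rfl, hab⟩
      exact h a b hab
    rw [homWeight, embWeight, if_pos h, if_pos h', ← prod_fiberwise univ σ]
    norm_cast
    refine prod_le_prod' fun x _ => ?_
    refine le_trans (le_of_eq (prod_congr rfl fun a ha => ?_)) (prod_ascFactorial_le _ _ _)
    simp [(mem_filter.1 ha).2]
  · rw [homWeight, if_neg h]
    exact embWeight_nonneg _ _ _ _

/-- The quotients of a finite type, presented as surjections onto `Fin p`. -/
structure FinQuotient (W : Type) [Fintype W] where
  size : Fin (Fintype.card W + 1)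
  map : W → Fin size
  surjective : Function.Surjective map

instance {W : Type} [Fintype W] : Fintype (FinQuotient W) :=
  Fintype.ofInjective
    (fun q => (⟨q.size, q.map⟩ : Σ p : Fin (Fintype.card W + 1), (W → Fin p))) (by
      rintro ⟨p, σ, hσ⟩ ⟨p', σ', hσ'⟩ h
      cases h
      rfl)

lemma sum_homWeight_le {W : Type} [Fintype W] {N : ℕ} (E : W → W → Prop) (ℓ : W → ℕ)
    (T : SimpleGraph (Fin N)) :
    ∑ ψ : W → Fin N, homWeight E ℓ T ψ
      ≤ ∑ q : FinQuotient W, embSum (pushRel q.map E) (pushLabel q.map ℓ) T := by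
  have key := sum_le_sum_of_cover (ι := Σ q : FinQuotient W, (Fin q.size → Fin N))
    (homWeight E ℓ T)
    (fun i => embWeight (pushRel i.1.map E) (pushLabel i.1.map ℓ) T i.2)
    (fun _ => embWeight_nonneg _ _ _ _) (fun i => i.2 ∘ i.1.map) ?_
  · rw [Fintype.sum_sigma] at key
    exact key
  intro ψ _
  have hcard : (univ.image ψ).card < Fintype.card W + 1 :=
    Nat.lt_succ_of_le card_image_le
  let e := (univ.image ψ).equivFin
  let σ : W → Fin (univ.image ψ).card := fun a => e ⟨ψ a, mem_image_of_mem ψ (mem_univ a)⟩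
  have hσ : Function.Surjective σ := by
    intro x
    obtain ⟨a, -, ha⟩ := mem_image.1 (e.symm x).2
    refine ⟨a, ?_⟩
    rw [← e.apply_symm_apply x]
    exact congrArg e (Subtype.ext ha)
  let φ : Fin (univ.image ψ).card → Fin N := fun x => (e.symm x).1
  have hφ : Function.Injective φ := Subtype.val_injective.comp e.symm.injective
  have hcomp : φ ∘ σ = ψ := by
    funext a
    simp [φ, σ]
  refine ⟨⟨⟨⟨_, hcard⟩, σ, hσ⟩, φ⟩, hcomp, ?_⟩
  exact (congrArg (homWeight E ℓ T) hcomp).symm.trans_le (homWeight_comp_le E ℓ T σ hφ)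

lemma Dval_nonneg (τ : DecTree) {m : ℕ} (T : SimpleGraph (Fin m)) : 0 ≤ Dval τ T := by
  refine sum_nonneg fun φ _ => ?_
  split_ifs
  · exact prod_nonneg fun _ _ => Nat.cast_nonneg _
  · exact le_rfl

lemma Dval_le (τ : DecTree) {m : ℕ} (T : SimpleGraph (Fin m)) :
    Dval τ T ≤ ∑ φ, homWeight τ.graph.Adj τ.label T φ := by
  refine sum_le_sum fun φ _ => ?_
  split_ifs with h
  · rw [homWeight, if_pos h.2]
    norm_cast
    exact prod_le_prod' fun u _ =>
      (Nat.descFactorial_le_pow _ _).trans (Nat.pow_succ_le_ascFactorial _ _)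
  · exact homWeight_nonneg _ _ _ _

lemma Dval_sq_le (τ : DecTree) {m : ℕ} (T : SimpleGraph (Fin m)) :
    Dval τ T ^ 2 ≤ ∑ q : FinQuotient (Fin τ.n ⊕ Fin τ.n),
      embSum (pushRel q.map (Sum.LiftRel τ.graph.Adj τ.graph.Adj))
        (pushLabel q.map (Sum.elim τ.label τ.label)) T := by
  refine le_trans ?_ (sum_homWeight_le (Sum.LiftRel τ.graph.Adj τ.graph.Adj)
    (Sum.elim τ.label τ.label) T)
  have h0 := Dval_nonneg τ T
  have h1 := Dval_le τ T
  calc Dval τ T ^ 2 ≤ (∑ φ, homWeight τ.graph.Adj τ.label T φ) ^ 2 := by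
        rw [sq_le_sq₀ h0 (h0.trans h1)]
        exact h1
    _ = ∑ p : (Fin τ.n → Fin m) × (Fin τ.n → Fin m),
          homWeight τ.graph.Adj τ.label T p.1 * homWeight τ.graph.Adj τ.label T p.2 := by
        rw [sq, sum_mul_sum, Fintype.sum_prod_type]
    _ = ∑ ψ : Fin τ.n ⊕ Fin τ.n → Fin m, homWeight (Sum.LiftRel τ.graph.Adj τ.graph.Adj)
          (Sum.elim τ.label τ.label) T ψ := by
        refine Fintype.sum_equiv (Equiv.sumArrowEquivProdArrow _ _ _).symm _ _ fun p => ?_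
        exact (homWeight_sumElim _ _ _ _ T p.1 p.2).symm
    _ ≤ _ := le_of_eq (by congr!)

lemma DecTree.isHeavy (τ : DecTree) (hw : 1 < τ.weight) : IsHeavy τ.graph.Adj τ.label := by
  intro u
  refine ⟨τ.label_pos u, ?_⟩
  by_cases h : 2 ≤ τ.label u
  · exact Or.inl h
  right
  have hex : ∃ b, b ≠ u := by
    by_contra hall
    push Not at hall
    have : τ.weight = τ.label u := by
      rw [DecTree.weight]
      exact sum_eq_single u (fun b _ hb => absurd (hall b) hb) (fun h => absurd (mem_univ _) h)
    omega
  have : Nontrivial (Fin τ.n) := let ⟨b, hb⟩ := hex; ⟨b, u, hb⟩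
  obtain ⟨b, hb⟩ := τ.isTree.connected.preconnected.exists_adj_of_nontrivial u
  exact ⟨b, hb.ne', Or.inl hb⟩

lemma IsHeavy.liftRel {V W : Type} {E : V → V → Prop} {E' : W → W → Prop} {ℓ : V → ℕ} {ℓ' : W → ℕ}
    (h : IsHeavy E ℓ) (h' : IsHeavy E' ℓ') : IsHeavy (Sum.LiftRel E E') (Sum.elim ℓ ℓ') := by
  rintro (u | u)
  · refine ⟨(h u).1, (h u).2.imp id ?_⟩
    rintro ⟨b, hb, hE⟩
    exact ⟨Sum.inl b, fun e => hb (Sum.inl_injective e), hE.imp .inl .inl⟩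
  · refine ⟨(h' u).1, (h' u).2.imp id ?_⟩
    rintro ⟨b, hb, hE⟩
    exact ⟨Sum.inr b, fun e => hb (Sum.inr_injective e), hE.imp .inr .inr⟩

lemma lawAt_add {n₀ : ℕ} (S : SimpleGraph (Fin n₀)) (k : ℕ) (G : SimpleGraph (Fin (n₀ + k))) :
    lawAt S (n₀ + k) G = law S k G := by
  have key : ∀ (j : ℕ) (h : SimpleGraph (Fin (n₀ + k)) = SimpleGraph (Fin (n₀ + j))), j = k →
      law S j (cast h G) = law S k G := by
    rintro j h rfl
    rfl
  rw [lawAt, dif_pos (Nat.le_add_right _ _)]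
  exact key _ _ (Nat.add_sub_cancel_left _ _)

lemma exists_expect_Dval_sq_le (τ : DecTree) (hw : 1 < τ.weight) {n₀ : ℕ}
    {S : SimpleGraph (Fin n₀)} (hS : S.IsTree) (hn₀ : 2 ≤ n₀) :
    ∃ C : ℝ, 0 ≤ C ∧ ∀ k : ℕ, expect S k (fun G => Dval τ G ^ 2) ≤
      C * ((n₀ + k : ℕ) : ℝ) ^ (τ.weight : ℝ) *
        (1 + Real.log ((n₀ + k : ℕ) : ℝ)) ^ (Fintype.card (Fin τ.n ⊕ Fin τ.n)) := by
  have hheavy := (τ.isHeavy hw).liftRel (τ.isHeavy hw)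
  choose C hC hbd using fun q : FinQuotient (Fin τ.n ⊕ Fin τ.n) =>
    hasMeanBound hS hn₀ _ _ (hheavy.push q.surjective)
  refine ⟨∑ q, C q, sum_nonneg fun q _ => hC q, fun k => ?_⟩
  refine (expect_mono hS hn₀ k fun G _ => Dval_sq_le τ G).trans ?_
  rw [expect_sum, sum_mul, sum_mul]
  refine sum_le_sum fun q _ => (hbd q k).trans ?_
  have hM : (1 : ℝ) ≤ (n₀ : ℝ) - 1 + k := by
    have h1 : (2 : ℝ) ≤ n₀ := by exact_mod_cast hn₀
    have h2 : (0 : ℝ) ≤ k := k.cast_nonneg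
    linarith
  have hMn : (n₀ : ℝ) - 1 + k ≤ ((n₀ + k : ℕ) : ℝ) := by
    push_cast
    linarith
  have hlog := Real.log_nonneg hM
  have hlog' : Real.log ((n₀ : ℝ) - 1 + k) ≤ Real.log ((n₀ + k : ℕ) : ℝ) :=
    Real.log_le_log (by linarith) hMn
  have hweight : ((∑ x, pushLabel q.map (Sum.elim τ.label τ.label) x : ℕ) : ℝ) / 2 = τ.weight := by
    rw [sum_pushLabel, Fintype.sum_sum_type]
    simp only [Sum.elim_inl, Sum.elim_inr, DecTree.weight]
    push_cast
    ring
  rw [hweight]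
  have hCq := hC q
  calc C q * ((n₀ : ℝ) - 1 + k) ^ (τ.weight : ℝ) *
        (1 + Real.log ((n₀ : ℝ) - 1 + k)) ^ (q.size : ℕ)
      ≤ C q * ((n₀ + k : ℕ) : ℝ) ^ (τ.weight : ℝ) *
        (1 + Real.log ((n₀ + k : ℕ) : ℝ)) ^ (q.size : ℕ) := by gcongr
    _ ≤ _ := by
      gcongr
      · linarith
      · exact Nat.lt_succ_iff.1 q.size.2

end

/-- For every decorated tree `τ` with `w(τ) > 1` and every seed tree `S`, the second moments
satisfy `E[D_τ(T_n^{(S)})²] ≪ n^{w(τ)}`. -/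
theorem second_moment_bound (τ : DecTree) (hw : 1 < τ.weight)
    {n₀ : ℕ} (S : SimpleGraph (Fin n₀)) (hS : S.IsTree) (hn₀ : 2 ≤ n₀) :
    Lsim (fun n => ∑ G : SimpleGraph (Fin n), lawAt S n G * Dval τ G ^ 2)
      (fun n => (n : ℝ) ^ (τ.weight : ℝ)) := by
  obtain ⟨C, hC, hbd⟩ := exists_expect_Dval_sq_le τ hw hS hn₀
  set P := Fintype.card (Fin τ.n ⊕ Fin τ.n)
  refine ⟨C * 2 ^ P + 1, P, by positivity, ?_⟩
  filter_upwards [Filter.eventually_ge_atTop (max n₀ 3)] with n hn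
  obtain ⟨k, rfl⟩ := Nat.exists_eq_add_of_le ((le_max_left _ _).trans hn)
  have hsum : ∑ G : SimpleGraph (Fin (n₀ + k)), lawAt S (n₀ + k) G * Dval τ G ^ 2
      = expect S k (fun G => Dval τ G ^ 2) := by
    simp only [lawAt_add, expect]
  have hnonneg : 0 ≤ expect S k (fun G => Dval τ G ^ 2) :=
    sum_nonneg fun G _ => mul_nonneg (law_nonneg S hn₀ k G) (sq_nonneg _)
  have h3 : (3 : ℝ) ≤ ((n₀ + k : ℕ) : ℝ) := by exact_mod_cast (le_max_right _ _).trans hn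
  rw [hsum, abs_of_nonneg hnonneg]
  refine (hbd k).trans ?_
  set x : ℝ := ((n₀ + k : ℕ) : ℝ)
  have hx : 0 ≤ x := by linarith
  have hlog : 1 ≤ Real.log x := by
    rw [Real.le_log_iff_exp_le (by linarith)]
    exact Real.exp_one_lt_three.le.trans h3
  rw [abs_of_nonneg (by positivity), Real.rpow_natCast (Real.log x)]
  calc C * x ^ (τ.weight : ℝ) * (1 + Real.log x) ^ P
      ≤ C * x ^ (τ.weight : ℝ) * (2 * Real.log x) ^ P := by
        gcongr
        linarith
    _ = C * 2 ^ P * Real.log x ^ P * x ^ (τ.weight : ℝ) := by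
        rw [mul_pow]
        ring
    _ ≤ (C * 2 ^ P + 1) * Real.log x ^ P * x ^ (τ.weight : ℝ) := by
        gcongr
        linarith

end LPAM
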